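/- Let g be a finite-dimensional semisimple Lie algebra over ℂ, let (e, h, f) be an sl₂-triple in g (so [h,e] = 2e, [h,f] = −2f, [e,f] = h, with e ≠ 0), and let κ be the Killing form of g. Then the bilinear form ⟨x, y⟩ = κ(f, [x, y]) on the eigenspace g_{1/2} = {x ∈ g : [h, x] = x} is alternating and nondegenerate (a symplectic form on g_{1/2}). -/

import Mathlib

open LieModule

namespace IsSl2Triple

variable {K L M : Type*} [Field K] [CharZero K] [LieRing L] [LieAlgebra K L]
  [AddCommGroup M] [Module K M] [LieRingModule L M] [LieModule K L M]
  {h e f : L}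

/-- In a finite-dimensional representation, the raising operator of an `sl₂`-triple is nilpotent. -/
lemma isNilpotent_toEnd_e [FiniteDimensional K M] (t : IsSl2Triple h e f) :
    IsNilpotent (toEnd K L M e) := by
  by_contra contra
  have hne (n : ℕ) : toEnd K L M e ^ n ≠ 0 := fun hn ↦ contra ⟨n, hn⟩
  have hcomm (n : ℕ) : ⁅toEnd K L M h, toEnd K L M e ^ n⁆ = (2 * n : K) • toEnd K L M e ^ n := by
    ext m
    induction n with
    | zero => simp [Ring.lie_def]
    | succ n ih =>
      simp only [Ring.lie_def, LinearMap.sub_apply, Module.End.mul_apply, toEnd_apply_apply,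
        LinearMap.smul_apply, pow_succ' (toEnd K L M e) n] at ih ⊢
      rw [leibniz_lie h e, t.lie_h_e_smul K, add_sub_assoc, ← lie_sub, ih, smul_lie, lie_smul,
        ← add_smul]
      congr 1
      push_cast
      ring
  have hinj : Function.Injective fun n : ℕ ↦ (2 * n : K) := fun a b hab ↦ by simpa using hab
  have := Module.End.eigenvectors_linearIndependent'
    (LinearMap.mulLeft K (toEnd K L M h) - LinearMap.mulRight K (toEnd K L M h))
    (fun n : ℕ ↦ (2 * n : K)) hinj (fun n ↦ toEnd K L M e ^ n)
    fun n ↦ ⟨by simpa [Module.End.mem_eigenspace_iff, Ring.lie_def] using hcomm n, hne n⟩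
  have := this.finite
  exact not_finite ℕ

/-- Commuting `f` past a power of `e`, applied to an eigenvector of `h`. -/
lemma pow_succ_toEnd_e_lie_f (t : IsSl2Triple h e f) {μ : K} {m : M} (hm : ⁅h, m⁆ = μ • m)
    (k : ℕ) :
    (toEnd K L M e ^ (k + 1)) ⁅f, m⁆ =
      ⁅f, (toEnd K L M e ^ (k + 1)) m⁆ + ((k + 1) * (μ + k)) • (toEnd K L M e ^ k) m := by
  induction k with
  | zero => simp [leibniz_lie e, t.lie_e_f, hm, add_comm]
  | succ k ih =>
    rw [pow_succ' _ (k + 1), Module.End.mul_apply, toEnd_apply_apply, ih, lie_add, leibniz_lie e,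
      t.lie_e_f, t.lie_h_pow_toEnd_e hm, lie_smul, lie_e_pow_toEnd_e, lie_e_pow_toEnd_e,
      ← pow_succ' _ (k + 1)]
    push_cast
    module

/-- The raising operator maps onto the `μ`-eigenspace of `h`, provided `μ` is not a non-positive
integer. -/
lemma exists_lie_e_eq [FiniteDimensional K M] (t : IsSl2Triple h e f) {μ : K}
    (hμ : ∀ k : ℕ, μ + k ≠ 0) {m : M} (hm : ⁅h, m⁆ = μ • m) :
    ∃ z : M, ⁅h, z⁆ = (μ - 2) • z ∧ ⁅e, z⁆ = m := by
  obtain ⟨k, hk⟩ := t.isNilpotent_toEnd_e (K := K) (M := M)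
  replace hk : (toEnd K L M e ^ k) m = 0 := by simp [hk]
  induction k generalizing m with
  | zero => exact ⟨0, by simpa using hk.symm⟩
  | succ k ih =>
    set a : K := (k + 1) * (μ + k) with ha
    have ha₀ : a ≠ 0 := mul_ne_zero (Nat.cast_add_one_ne_zero k) (hμ k)
    have hf : ⁅h, ⁅f, m⁆⁆ = (μ - 2) • ⁅f, m⁆ := by
      rw [leibniz_lie h, t.lie_lie_smul_f K, hm, neg_lie, smul_lie, lie_smul]
      module
    have hef : ⁅h, ⁅e, ⁅f, m⁆⁆⁆ = μ • ⁅e, ⁅f, m⁆⁆ := by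
      rw [leibniz_lie h, t.lie_h_e_smul K, hf, smul_lie, lie_smul]
      module
    obtain ⟨z, hz, hz'⟩ := ih (m := m - a⁻¹ • ⁅e, ⁅f, m⁆⁆)
      (by rw [lie_sub, lie_smul, hef, hm]; module) (by
        have := t.pow_succ_toEnd_e_lie_f hm k
        rw [hk, lie_zero, zero_add, pow_succ, Module.End.mul_apply, toEnd_apply_apply] at this
        rw [map_sub, map_smul, this, inv_smul_smul₀ ha₀, sub_self])
    refine ⟨z + a⁻¹ • ⁅f, m⁆, ?_, ?_⟩
    · rw [lie_add, lie_smul, hz, hf]; module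
    · rw [lie_add, lie_smul, hz']; module

/-- The actions of `h` and `e` on the string generated under `f` by a vector `w` that is
annihilated by `e` and satisfies `⁅h, w⁆ = μ • w + u`. -/
lemma lie_h_and_lie_e_pow_toEnd_f_of_lie_h_eq_add (t : IsSl2Triple h e f) {μ : K} {u w : M}
    (hw : ⁅h, w⁆ = μ • w + u) (hew : ⁅e, w⁆ = 0) (k : ℕ) :
    ⁅h, (toEnd K L M f ^ k) w⁆ =
        (μ - 2 * k) • (toEnd K L M f ^ k) w + (toEnd K L M f ^ k) u ∧
      ⁅e, (toEnd K L M f ^ (k + 1)) w⁆ =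
        ((k + 1) * (μ - k)) • (toEnd K L M f ^ k) w + (k + 1 : K) • (toEnd K L M f ^ k) u := by
  induction k with
  | zero => simp [leibniz_lie e, t.lie_e_f, hw, hew]
  | succ k ih =>
    obtain ⟨ih₁, ih₂⟩ := ih
    have hh : ⁅h, (toEnd K L M f ^ (k + 1)) w⁆ =
        (μ - 2 * (k + 1 : ℕ)) • (toEnd K L M f ^ (k + 1)) w + (toEnd K L M f ^ (k + 1)) u := by
      simp only [pow_succ' _ k, Module.End.mul_apply, toEnd_apply_apply]
      rw [leibniz_lie h, t.lie_lie_smul_f K, ih₁, neg_lie, smul_lie, lie_add, lie_smul]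
      push_cast
      module
    refine ⟨hh, ?_⟩
    rw [pow_succ' _ (k + 1), Module.End.mul_apply, toEnd_apply_apply, leibniz_lie e, t.lie_e_f, hh,
      ih₂, lie_add, lie_smul, lie_smul]
    simp only [pow_succ' _ k, Module.End.mul_apply, toEnd_apply_apply]
    push_cast
    module

/-- A primitive vector with natural weight is not in the image of a Jordan block of `h`
consisting of vectors annihilated by `e`. -/
lemma eq_zero_of_lie_h_eq_add_of_lie_e_eq_zero [FiniteDimensional K M] (t : IsSl2Triple h e f)
    {n : ℕ} {u w : M} (hu : ⁅h, u⁆ = (n : K) • u) (hw : ⁅h, w⁆ = (n : K) • w + u)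
    (heu : ⁅e, u⁆ = 0) (hew : ⁅e, w⁆ = 0) : u = 0 := by
  by_contra hu₀
  have P : t.HasPrimitiveVectorWith u (n : K) := ⟨hu₀, hu, heu⟩
  have key (k : ℕ) := (t.lie_h_and_lie_e_pow_toEnd_f_of_lie_h_eq_add hw hew k).2
  have hfu (j : ℕ) : (toEnd K L M f ^ (n + 1 + j)) u = 0 := by
    rw [add_comm, pow_add, Module.End.mul_apply, P.pow_toEnd_f_eq_zero_of_eq_nat rfl, map_zero]
  obtain ⟨N, hN⟩ := t.symm.isNilpotent_toEnd_e (K := K) (M := M)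
  have hfw (j : ℕ) (hj : (toEnd K L M f ^ (n + 1 + j)) w = 0) :
      (toEnd K L M f ^ (n + 1)) w = 0 := by
    induction j with
    | zero => exact hj
    | succ j ih =>
      refine ih ?_
      have := key (n + 1 + j)
      rw [add_assoc (n + 1) j 1, hj, lie_zero, hfu, smul_zero, add_zero, eq_comm,
        smul_eq_zero] at this
      refine this.resolve_left (mul_ne_zero (Nat.cast_add_one_ne_zero _) ?_)
      have : (n : K) - (n + 1 + j : ℕ) = -((j : K) + 1) := by push_cast; ring
      rw [this]
      exact neg_ne_zero.mpr (Nat.cast_add_one_ne_zero j)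
  have := key n
  rw [hfw N (by rw [pow_add, hN, mul_zero, LinearMap.zero_apply]), lie_zero, sub_self, mul_zero,
    zero_smul, zero_add, eq_comm, smul_eq_zero] at this
  exact P.pow_toEnd_f_ne_zero_of_eq_nat rfl le_rfl
    (this.resolve_left (Nat.cast_add_one_ne_zero n))

/-- In a finite-dimensional representation, `h` has no nontrivial Jordan blocks for a natural
eigenvalue. -/
lemma eq_zero_of_lie_h_eq_add [FiniteDimensional K M] (t : IsSl2Triple h e f)
    {n : ℕ} {u w : M} (hu : ⁅h, u⁆ = (n : K) • u) (hw : ⁅h, w⁆ = (n : K) • w + u) : u = 0 := by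
  obtain ⟨k, hk⟩ := t.isNilpotent_toEnd_e (K := K) (M := M)
  replace hk : (toEnd K L M e ^ k) u = 0 := by simp [hk]
  induction k generalizing n u w with
  | zero => simpa using hk
  | succ k ih =>
    have heu : ⁅e, u⁆ = 0 := by
      refine ih (n := n + 2) (w := ⁅e, w⁆) ?_ ?_ (by simpa [pow_succ] using hk)
      · rw [leibniz_lie h, t.lie_h_e_smul K, hu, smul_lie, lie_smul]
        push_cast
        module
      · rw [leibniz_lie h, t.lie_h_e_smul K, hw, smul_lie, lie_add, lie_smul]
        push_cast
        module
    obtain ⟨z, hz, hz'⟩ := t.exists_lie_e_eq (μ := (n + 2 : K)) (m := ⁅e, w⁆)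
      (fun k ↦ by exact_mod_cast (by omega : n + 2 + k ≠ 0)) (by
        rw [leibniz_lie h, t.lie_h_e_smul K, hw, smul_lie, lie_add, lie_smul, heu]
        module)
    refine t.eq_zero_of_lie_h_eq_add_of_lie_e_eq_zero (w := w - z) hu ?_ heu ?_
    · rw [lie_sub, hw, hz]
      module
    · rw [lie_sub, hz', sub_self]

end IsSl2Triple

/-- If `v` is Killing-orthogonal to the `μ`-eigenspace of `ad h`, then `v` lies in the range of
`ad h + μ`. -/
lemma LieAlgebra.IsKilling.exists_lie_add_smul_eq {K L : Type*} [Field K] [LieRing L]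
    [LieAlgebra K L] [FiniteDimensional K L] [LieAlgebra.IsKilling K L] (h v : L) (μ : K)
    (hv : ∀ y : L, ⁅h, y⁆ = μ • y → killingForm K L v y = 0) :
    ∃ w : L, ⁅h, w⁆ + μ • w = v := by
  set T : Module.End K L := LieAlgebra.ad K L h - μ • 1 with hT
  have hmem : killingForm K L v ∈ (LinearMap.ker T).dualAnnihilator := by
    rw [Submodule.mem_dualAnnihilator]
    intro y hy
    exact hv y (by simpa [hT, sub_eq_zero] using hy)
  rw [← LinearMap.range_dualMap_eq_dualAnnihilator_ker] at hmem
  obtain ⟨ψ, hψ⟩ := hmem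
  have hnd := LieAlgebra.IsKilling.killingForm_nondegenerate K L
  obtain ⟨w, rfl⟩ := (LinearMap.BilinForm.toDual (killingForm K L) hnd).surjective ψ
  refine ⟨-w, sub_eq_zero.mp (hnd.1 _ fun y ↦ ?_)⟩
  have hy := LinearMap.congr_fun hψ y
  have hinv : killingForm K L ⁅w, h⁆ y = killingForm K L w ⁅h, y⁆ :=
    LieModule.traceForm_apply_lie_apply K L L w h y
  rw [← lie_skew, map_neg, LinearMap.neg_apply] at hinv
  simp only [hT, LinearMap.dualMap_apply, LinearMap.BilinForm.toDual_def, LinearMap.sub_apply,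
    LieAlgebra.ad_apply, LinearMap.smul_apply, Module.End.one_apply, map_sub, map_smul] at hy
  simp only [lie_neg, smul_neg, map_sub, map_add, map_neg, map_smul, LinearMap.sub_apply,
    LinearMap.add_apply, LinearMap.neg_apply, LinearMap.smul_apply]
  rw [hinv, hy.symm]
  ring


/-- For an `sl₂`-triple `(e, h, f)` in a finite-dimensional semisimple complex Lie
algebra `g` with Killing form `κ`, the bilinear form `⟨x, y⟩ = κ(f, [x, y])` on
the eigenspace `g_{1/2} = {x : [h, x] = x}` is alternating and nondegenerate. -/
theorem symplectic_form_on_half_eigenspace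
    (L : Type*) [LieRing L] [LieAlgebra ℂ L] [FiniteDimensional ℂ L]
    [LieAlgebra.IsSemisimple ℂ L]
    (e h f : L) (he : e ≠ 0)
    (h1 : ⁅h, e⁆ = (2 : ℂ) • e) (h2 : ⁅h, f⁆ = (-2 : ℂ) • f) (h3 : ⁅e, f⁆ = h) :
    (∀ x : L, ⁅h, x⁆ = x → killingForm ℂ L f ⁅x, x⁆ = 0) ∧
    (∀ x : L, ⁅h, x⁆ = x → x ≠ 0 →
      ∃ y : L, ⁅h, y⁆ = y ∧ killingForm ℂ L f ⁅x, y⁆ ≠ 0) := by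
  have t : IsSl2Triple h e f :=
    { h_ne_zero := by
        intro hh
        rw [hh, zero_lie, eq_comm, smul_eq_zero] at h1
        exact h1.elim two_ne_zero he
      lie_e_f := h3
      lie_h_e_nsmul := by rw [h1, ofNat_smul_eq_nsmul]
      lie_h_f_nsmul := by rw [h2, neg_smul, ofNat_smul_eq_nsmul] }
  refine ⟨fun x _ ↦ by simp, fun x hx hx₀ ↦ ?_⟩
  by_contra! contra
  have hv₀ : ⁅f, x⁆ ≠ 0 := by
    intro hfx
    have P : t.symm.HasPrimitiveVectorWith x (-1 : ℂ) := ⟨hx₀, by simp [hx], hfx⟩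
    obtain ⟨n, hn⟩ := P.exists_nat
    refine Nat.cast_add_one_ne_zero (R := ℂ) n ?_
    rw [← hn]
    ring
  have hv : ⁅h, ⁅f, x⁆⁆ = -⁅f, x⁆ := by
    rw [leibniz_lie h, h2, hx, smul_lie]
    module
  obtain ⟨w, hw⟩ := LieAlgebra.IsKilling.exists_lie_add_smul_eq h ⁅f, x⁆ (1 : ℂ) fun y hy ↦ by
    rw [← contra y (by simpa using hy)]
    exact LieModule.traceForm_apply_lie_apply ℂ L L f x y
  refine hv₀ (t.symm.eq_zero_of_lie_h_eq_add (K := ℂ) (n := 1) (w := -w) ?_ ?_)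
  · simp [hv]
  · rw [← hw]
    simp
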